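/- arXiv:0711.2296 — 3 statements merged into one kernel-verified Lean document; each statement's English description precedes it below -/
import Mathlib

section
/- Let g = ⊕_{j ∈ (1/2)ℤ} g_j be the ad x eigenspace decomposition of a semisimple Lie algebra g with respect to an sl₂-triple (e,x,f), and let g₀^f be the centralizer of f inside g₀. Then for each j, the g₀^f-modules g_j and g_{-j} are isomorphic (contragredient to each other and isomorphic via (ad f)^{2j}); in particular tr_{g_j}(ad a) = 0 for all a ∈ g₀^f. -/
open Module

/-- Endomorphisms `E`, `X`, `F` satisfying the relations `[X, E] = E`, `[X, F] = -F`, `[E, F] = X`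
of an `sl₂`-triple normalised so that `X` acts on `E` with eigenvalue `1`. -/
structure IsHalfSl2Rep {K V : Type*} [Field K] [AddCommGroup V] [Module K V]
    (E X F : End K V) : Prop where
  X_E : ∀ v, X (E v) = E (X v) + E v
  X_F : ∀ v, X (F v) = F (X v) - F v
  E_F : ∀ v, E (F v) = F (E v) + X v

namespace IsHalfSl2Rep

variable {K V : Type*} [Field K] [AddCommGroup V] [Module K V]
  {E X F : End K V}

lemma symm (h : IsHalfSl2Rep E X F) : IsHalfSl2Rep F (-X) E where
  X_E v := by simp [h.X_F]; abel
  X_F v := by simp [h.X_E]; abel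
  E_F v := by simp [h.E_F]

lemma X_pow_E (h : IsHalfSl2Rep E X F) (n : ℕ) (v : V) :
    X ((E ^ n) v) = (E ^ n) (X v) + (n : K) • (E ^ n) v := by
  induction n with
  | zero => simp
  | succ n ih =>
    simp only [pow_succ', End.mul_apply, h.X_E, ih, map_add, map_smul]
    push_cast
    module

lemma X_pow_F (h : IsHalfSl2Rep E X F) (n : ℕ) (v : V) :
    X ((F ^ n) v) = (F ^ n) (X v) - (n : K) • (F ^ n) v := by
  have := h.symm.X_pow_E n v
  simp only [LinearMap.neg_apply, map_neg] at this
  rw [← neg_inj, this]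
  abel

lemma mapsTo_pow_F (h : IsHalfSl2Rep E X F) {j : K} {m : ℕ} (hm : 2 * j = m) :
    ∀ v ∈ X.eigenspace j, (F ^ m) v ∈ X.eigenspace (-j) := fun v hv ↦ by
  rw [End.mem_eigenspace_iff] at hv ⊢
  rw [h.X_pow_F, hv, map_smul, ← sub_smul, ← hm]
  congr 1
  ring

variable [CharZero K]

lemma E_pow_succ_F (h : IsHalfSl2Rep E X F) (n : ℕ) (v : V) :
    E ((F ^ (n + 1)) v) =
      (F ^ (n + 1)) (E v) + ((n : K) + 1) • (F ^ n) (X v - ((n : K) / 2) • v) := by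
  induction n with
  | zero => simp [h.E_F]
  | succ n ih =>
    rw [pow_succ', End.mul_apply, h.E_F, ih, h.X_pow_F]
    simp only [map_add, map_smul, map_sub, pow_succ' F n, End.mul_apply]
    push_cast
    module

lemma eq_zero_of_pow_F_eq_zero_of_E_eq_zero (h : IsHalfSl2Rep E X F) {j : K} {m : ℕ}
    (hm : 2 * j = m) {v : V} (hv : X v = j • v) (hE : E v = 0) {i : ℕ} (hi : i ≤ m)
    (hF : (F ^ i) v = 0) : v = 0 := by
  induction i with
  | zero => simpa using hF
  | succ i ih =>
    refine ih (by lia) ?_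
    have := h.E_pow_succ_F i v
    rw [hF, hE, hv, ← sub_smul, map_smul, smul_smul, map_zero, map_zero, zero_add, eq_comm,
      smul_eq_zero] at this
    refine this.resolve_left (mul_ne_zero (Nat.cast_add_one_ne_zero i) fun H ↦ ?_)
    have : (m : K) = i := by linear_combination 2 * H - hm
    have := Nat.cast_injective this
    lia

variable [FiniteDimensional K V]

lemma exists_pow_E_eq_zero (h : IsHalfSl2Rep E X F) {j : K} {v : V} (hv : X v = j • v) :
    ∃ n, (E ^ n) v = 0 := by
  by_contra! H
  have hinj : Function.Injective fun n : ℕ ↦ j + (n : K) := fun a b hab ↦ by simpa using hab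
  refine Set.infinite_range_of_injective hinj ((End.finite_hasEigenvalue X).subset ?_)
  rintro _ ⟨n, rfl⟩
  refine End.hasEigenvalue_of_hasEigenvector (x := (E ^ n) v)
    ⟨End.mem_eigenspace_iff.mpr ?_, H n⟩
  rw [h.X_pow_E, hv, map_smul, add_smul]

/-- The weight of a highest weight vector is a nonnegative half-integer. -/
lemma exists_nat (h : IsHalfSl2Rep E X F) {j : K} {v : V} (hv : X v = j • v) (hE : E v = 0)
    (h0 : v ≠ 0) : ∃ n : ℕ, 2 * j = n := by
  have hX : (-X) v = (-j) • v := by simp [hv]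
  obtain ⟨n, hn, hn'⟩ := Nat.exists_not_and_succ_of_not_zero_of_exists
    (p := fun n ↦ (F ^ n) v = 0) (by simpa using h0) (h.symm.exists_pow_E_eq_zero hX)
  refine ⟨n, ?_⟩
  have := h.E_pow_succ_F n v
  rw [hn', hE, hv, ← sub_smul, map_smul, smul_smul, map_zero, map_zero, zero_add, eq_comm,
    smul_eq_zero_iff_left hn, mul_eq_zero] at this
  have := this.resolve_left (Nat.cast_add_one_ne_zero n)
  linear_combination 2 * this

lemma exists_int (h : IsHalfSl2Rep E X F) {j : K} {v : V} (hv : X v = j • v) (h0 : v ≠ 0) :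
    ∃ n : ℤ, 2 * j = n := by
  obtain ⟨n, hn, hn'⟩ := Nat.exists_not_and_succ_of_not_zero_of_exists
    (p := fun n ↦ (E ^ n) v = 0) (by simpa using h0) (h.exists_pow_E_eq_zero hv)
  have hw : X ((E ^ n) v) = (j + n) • (E ^ n) v := by rw [h.X_pow_E, hv, map_smul, add_smul]
  rw [pow_succ', End.mul_apply] at hn'
  obtain ⟨m, hm⟩ := h.exists_nat hw hn' hn
  exact ⟨m - 2 * n, by push_cast; linear_combination hm⟩

lemma eq_zero_of_pow_F_eq_zero (h : IsHalfSl2Rep E X F) {j : K} {m : ℕ}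
    (hm : 2 * j = m) {v : V} (hv : X v = j • v) (hF : (F ^ m) v = 0) : v = 0 := by
  obtain ⟨k, hk⟩ := h.exists_pow_E_eq_zero hv
  induction k generalizing j m v with
  | zero => simpa using hk
  | succ k ih =>
    refine h.eq_zero_of_pow_F_eq_zero_of_E_eq_zero hm hv ?_ le_rfl hF
    have hF' : (F ^ (m + 1)) v = 0 := by rw [pow_succ', End.mul_apply, hF, map_zero]
    have hF'' : (F ^ (m + 1 + 1)) v = 0 := by rw [pow_succ', End.mul_apply, hF', map_zero]
    refine ih (j := j + 1) (m := m + 2) (by push_cast; linear_combination hm) ?_ ?_ ?_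
    · rw [h.X_E, hv, map_smul, add_smul, one_smul]
    · have := h.E_pow_succ_F (m + 1) v
      rw [hF'', hv, ← sub_smul, map_smul, hF', map_zero, smul_zero, smul_zero, add_zero] at this
      exact this.symm
    · rwa [pow_succ, End.mul_apply] at hk

lemma finrank_eigenspace_le (h : IsHalfSl2Rep E X F) {j : K} {m : ℕ} (hm : 2 * j = m) :
    finrank K (X.eigenspace j) ≤ finrank K (X.eigenspace (-j)) := by
  refine LinearMap.finrank_le_finrank_of_injective
    (f := (F ^ m).restrict (h.mapsTo_pow_F hm)) ?_
  refine (injective_iff_map_eq_zero _).mpr fun v hv ↦ Subtype.ext ?_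
  exact h.eq_zero_of_pow_F_eq_zero hm (End.mem_eigenspace_iff.mp v.2) congr($hv)

/-- `F ^ (2 * j)` is an isomorphism from the weight space of weight `j` to that of weight `-j`. -/
lemma exists_equiv_pow_F (h : IsHalfSl2Rep E X F) {j : K} {m : ℕ} (hm : 2 * j = m) :
    ∃ φ : X.eigenspace j ≃ₗ[K] X.eigenspace (-j), ∀ v, (φ v : V) = (F ^ m) v := by
  have hneg (μ : K) : (-X).eigenspace μ = X.eigenspace (-μ) := by
    ext v
    simp [neg_eq_iff_eq_neg]
  have hle := h.symm.finrank_eigenspace_le hm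
  rw [hneg, hneg, neg_neg] at hle
  have hinj : Function.Injective ((F ^ m).restrict (h.mapsTo_pow_F hm)) :=
    (injective_iff_map_eq_zero _).mpr fun v hv ↦ Subtype.ext <|
      h.eq_zero_of_pow_F_eq_zero hm (End.mem_eigenspace_iff.mp v.2) congr($hv)
  have hbij : Function.Bijective ((F ^ m).restrict (h.mapsTo_pow_F hm)) :=
    ⟨hinj, (LinearMap.injective_iff_surjective_of_finrank_eq_finrank
      ((h.finrank_eigenspace_le hm).antisymm hle)).mp hinj⟩
  refine ⟨LinearEquiv.ofBijective _ hbij, fun v ↦ ?_⟩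
  rw [LinearEquiv.ofBijective_apply, LinearMap.coe_restrict_apply]

/-- The weight spaces of weights `j` and `-j` are isomorphic, compatibly with all endomorphisms
commuting with `X` and `F`. -/
lemma exists_equiv (h : IsHalfSl2Rep E X F) (j : K) :
    ∃ φ : X.eigenspace j ≃ₗ[K] X.eigenspace (-j),
      ∀ A : End K V, Commute A X → Commute A F → ∀ v w : X.eigenspace j,
        (w : V) = A v → (φ w : V) = A (φ v) := by
  have hcomm {A B : End K V} (hAB : Commute A B) (v : V) : A (B v) = B (A v) :=
    LinearMap.congr_fun hAB.eq v
  have hof {p q : Submodule K V} (hpq : p = q) : ∃ ι : p ≃ₗ[K] q, ∀ v, (ι v : V) = v :=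
    ⟨LinearEquiv.ofEq p q hpq, fun v ↦ LinearEquiv.coe_ofEq_apply hpq v⟩
  by_cases hj : ∃ n : ℤ, 2 * j = n
  · obtain ⟨n, hn⟩ := hj
    obtain ⟨m, rfl | rfl⟩ := n.eq_nat_or_neg
    · obtain ⟨φ, hφ⟩ := h.exists_equiv_pow_F (j := j) (m := m) (by simpa using hn)
      refine ⟨φ, fun A _ hF v w hw ↦ ?_⟩
      rw [hφ, hφ, hw, hcomm (hF.pow_right m)]
    · obtain ⟨i, rfl⟩ : ∃ i, j = -i := ⟨-j, by simp⟩
      have hm : 2 * i = m := by push_cast at hn; linear_combination -hn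
      obtain ⟨φ, hφ⟩ := h.exists_equiv_pow_F hm
      obtain ⟨ι, hι⟩ := hof (congrArg X.eigenspace (neg_neg i).symm)
      refine ⟨φ.symm.trans ι, fun A hX hF v w hw ↦ ?_⟩
      obtain ⟨v, rfl⟩ := φ.surjective v
      obtain ⟨w, rfl⟩ := φ.surjective w
      rw [LinearEquiv.trans_apply, LinearEquiv.trans_apply, LinearEquiv.symm_apply_apply,
        LinearEquiv.symm_apply_apply, hι, hι]
      have hA : A v ∈ X.eigenspace i := by
        rw [End.mem_eigenspace_iff, ← hcomm hX, End.mem_eigenspace_iff.mp v.2, map_smul]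
      have : w = ⟨A v, hA⟩ := by
        refine φ.injective (Subtype.ext ?_)
        rw [hw, hφ, hφ, hcomm (hF.pow_right m)]
      rw [this]
  · have hbot (i : K) (hi : i = j ∨ i = -j) : X.eigenspace i = ⊥ := by
      refine (Submodule.eq_bot_iff _).mpr fun v hv ↦ by_contra fun h0 ↦ hj ?_
      obtain ⟨n, hn⟩ := h.exists_int (End.mem_eigenspace_iff.mp hv) h0
      obtain rfl | rfl := hi
      · exact ⟨n, hn⟩
      · exact ⟨-n, by push_cast; linear_combination -hn⟩
    obtain ⟨ι, hι⟩ := hof ((hbot j (.inl rfl)).trans (hbot (-j) (.inr rfl)).symm)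
    exact ⟨ι, fun A _ _ v w hw ↦ by rw [hι, hι, hw]⟩

lemma eq_zero_of_sub_mem_of_pow_E_eq_zero (h : IsHalfSl2Rep E X F) {j : K} {u v : V}
    (hv : X v = j • v + u) (hu : X u = j • u) {k : ℕ} (hk : (E ^ k) v = 0) : u = 0 := by
  induction k generalizing j u v with
  | zero => simp_all
  | succ k ih =>
    have hXEv : X (E v) = (j + 1) • E v + E u := by
      rw [h.X_E, hv, map_add, map_smul]
      module
    have hEu : E u = 0 := by
      refine ih hXEv ?_ (by rwa [pow_succ, End.mul_apply] at hk)
      rw [h.X_E, hu, map_smul, add_smul, one_smul]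
    rw [hEu, add_zero] at hXEv
    by_contra h0
    obtain ⟨m, hm⟩ := h.exists_nat hu hEu h0
    have hFu : (F ^ (m + 1)) u = 0 := by
      by_contra hne
      obtain ⟨n, hn⟩ := h.exists_nat (j := j - (m + 1)) (v := (F ^ (m + 1)) u)
        (by rw [h.X_pow_F, hu, map_smul]; push_cast; module)
        (by
          rw [h.E_pow_succ_F, hEu, hu, ← sub_smul, show j - (m : K) / 2 = 0 by
            linear_combination hm / 2]
          simp) hne
      have : ((n + m + 2 : ℕ) : K) = 0 := by push_cast; linear_combination hm - hn
      exact absurd (Nat.cast_eq_zero.mp this) (by lia)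
    obtain ⟨φ, hφ⟩ := h.exists_equiv_pow_F (j := j + 1) (m := m + 2)
      (by push_cast; linear_combination hm)
    have hFv : (F ^ (m + 1)) v ∈ X.eigenspace (-(j + 1)) := by
      rw [End.mem_eigenspace_iff, h.X_pow_F, hv, map_add, hFu, map_smul, add_zero, ← sub_smul]
      congr 1
      push_cast
      linear_combination hm
    obtain ⟨y, hy⟩ := φ.surjective ⟨_, hFv⟩
    have hy : (F ^ (m + 1)) (F y) = (F ^ (m + 1)) v := by
      rw [← End.mul_apply, ← pow_succ, ← hφ, hy]
    have hXy := End.mem_eigenspace_iff.mp y.2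
    -- After subtracting `F y`, the vector `v` is killed by `F ^ (m + 1)`.
    have hXv' : X (v - F y) = j • (v - F y) + u := by
      rw [map_sub, hv, h.X_F, hXy, map_smul]
      module
    have hFv' : (F ^ (m + 1)) (v - F y) = 0 := by rw [map_sub, hy, sub_self]
    have hsub : X (v - F y) - ((m : K) / 2) • (v - F y) = u := by
      rw [hXv', show (m : K) / 2 = j by linear_combination -hm / 2]
      abel
    have hrel := h.E_pow_succ_F m (v - F y)
    rw [hFv', hsub, map_zero] at hrel
    have hEv' : E (v - F y) = 0 := by
      refine h.eq_zero_of_pow_F_eq_zero (j := j + 1) (m := m + 2)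
        (by push_cast; linear_combination hm) ?_ ?_
      · rw [h.X_E, hXv', map_add, hEu, map_smul]
        module
      · have := congr(F $hrel)
        rw [map_zero, map_add, map_smul, ← End.mul_apply, ← pow_succ', ← End.mul_apply F,
          ← pow_succ', hFu, smul_zero, add_zero] at this
        exact this.symm
    rw [hEv', map_zero, zero_add, eq_comm, smul_eq_zero] at hrel
    exact h0 <| h.eq_zero_of_pow_F_eq_zero hm hu
      (hrel.resolve_left (Nat.cast_add_one_ne_zero m))

/-- `X` has no nontrivial Jordan blocks. -/
lemma eq_zero_of_sub_mem (h : IsHalfSl2Rep E X F) {j : K} {u v : V}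
    (hv : X v = j • v + u) (hu : X u = j • u) : u = 0 := by
  obtain ⟨k, hk⟩ := h.exists_pow_E_eq_zero hu
  have hkv : X ((E ^ k) v) = (j + k) • (E ^ k) v := by
    rw [h.X_pow_E, hv, map_add, hk, map_smul, add_zero, add_smul]
  obtain ⟨l, hl⟩ := h.exists_pow_E_eq_zero hkv
  rw [← End.mul_apply, ← pow_add] at hl
  exact h.eq_zero_of_sub_mem_of_pow_E_eq_zero hv hu hl

lemma exists_mem_eigenspace_add (h : IsHalfSl2Rep E X F) (j : K) (y : V) :
    ∃ w ∈ X.eigenspace j, ∃ v, y = w + (X v - j • v) := by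
  let N : End K V := X - j • 1
  have hdisj : Disjoint (LinearMap.ker N) (LinearMap.range N) := by
    rw [Submodule.disjoint_def]
    rintro _ hu ⟨v, rfl⟩
    refine h.eq_zero_of_sub_mem (j := j) (v := v) ?_ ?_
    · simp [N]
    · exact sub_eq_zero.mp (by simpa [N] using hu)
  have htop := Submodule.eq_top_of_disjoint _ _
    ((add_comm _ _).trans N.finrank_range_add_finrank_ker).ge hdisj
  obtain ⟨w, hw, _, ⟨v, rfl⟩, rfl⟩ := Submodule.mem_sup.mp (htop.ge (Submodule.mem_top (x := y)))
  refine ⟨w, ?_, v, by simp [N]⟩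
  rw [End.mem_eigenspace_iff]
  exact sub_eq_zero.mp (by simpa [N] using hw)

/-- For an `X`-invariant nondegenerate form, the weight spaces of weights `j` and `-j` are in
duality. -/
lemma eq_zero_of_orthogonal (h : IsHalfSl2Rep E X F) {B : LinearMap.BilinForm K V}
    (hB : B.SeparatingLeft) (hX : ∀ u v, B (X u) v = -B u (X v)) {j : K} {u : V}
    (hu : u ∈ X.eigenspace j) (hperp : ∀ w ∈ X.eigenspace (-j), B u w = 0) : u = 0 := by
  refine hB u fun y ↦ ?_
  obtain ⟨w, hw, v, rfl⟩ := h.exists_mem_eigenspace_add (-j) y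
  have := hX u v
  rw [End.mem_eigenspace_iff.mp hu, map_smul, LinearMap.smul_apply, smul_eq_mul] at this
  rw [map_add, hperp w hw, map_sub, map_smul, smul_eq_mul]
  linear_combination this

end IsHalfSl2Rep

/-- If an endomorphism `T` is both isomorphic to `S` and, through a perfect pairing, to minus the
transpose of `S`, then its trace vanishes. -/
lemma LinearMap.trace_eq_zero_of_pairing {K U W : Type*} [Field K] [CharZero K]
    [AddCommGroup U] [Module K U] [AddCommGroup W] [Module K W]
    [FiniteDimensional K U] (φ : U ≃ₗ[K] W) (B : U →ₗ[K] Dual K W)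
    (hB : Function.Injective B) (T : End K U)
    (hT : ∀ u v, B (T u) (φ v) = -B u (φ (T v))) : LinearMap.trace K U T = 0 := by
  have : FiniteDimensional K W := φ.finiteDimensional
  let β : U ≃ₗ[K] Dual K W := LinearEquiv.ofInjectiveOfFinrankEq B hB
    (by rw [Subspace.dual_finrank_eq, φ.finrank_eq])
  have hconj : β.conj T = -Dual.transpose (φ.conj T) := by
    ext ξ w
    obtain ⟨u, rfl⟩ := β.surjective ξ
    obtain ⟨v, rfl⟩ := φ.surjective w
    rw [LinearEquiv.conj_apply_apply, LinearEquiv.symm_apply_apply, LinearMap.neg_apply,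
      LinearMap.neg_apply, Dual.transpose_apply, LinearMap.comp_apply,
      LinearEquiv.conj_apply_apply, LinearEquiv.symm_apply_apply]
    exact hT u v
  have htr : LinearMap.trace K _ (β.conj T) =
      -LinearMap.trace K _ (Dual.transpose (R := K) (φ.conj T)) := by
    rw [hconj]
    exact map_neg (LinearMap.trace K (Dual K W)) _
  rw [LinearMap.trace_transpose', LinearMap.trace_conj', LinearMap.trace_conj'] at htr
  exact self_eq_neg.mp htr

/-- Lemma 2.9(b) of Kac–Wakimoto: for an `sl₂`-triple `(e,x,f)` in a finite-dimensional
complex semisimple Lie algebra, the `ad x`-eigenspaces `g_j` and `g_{-j}` are isomorphic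
as modules over the centralizer `g₀^f = {a : ⁅x,a⁆ = 0, ⁅f,a⁆ = 0}` (via `(ad f)^{2j}`,
and they are contragredient); in particular every `a ∈ g₀^f` acts on `g_j` with trace `0`. -/
theorem stmt4 {L : Type*} [LieRing L] [LieAlgebra ℂ L] [FiniteDimensional ℂ L]
    [LieAlgebra.IsSemisimple ℂ L]
    (e x f : L) (hxe : ⁅x, e⁆ = e) (hxf : ⁅x, f⁆ = -f) (hef : ⁅e, f⁆ = x)
    (j : ℂ) :
    ∃ φ : (Module.End.eigenspace ((LieAlgebra.ad ℂ L) x) j) ≃ₗ[ℂ]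
          (Module.End.eigenspace ((LieAlgebra.ad ℂ L) x) (-j)),
      (∀ a : L, ⁅x, a⁆ = 0 → ⁅f, a⁆ = 0 →
        ∀ v w : Module.End.eigenspace ((LieAlgebra.ad ℂ L) x) j,
          (w : L) = ⁅a, (v : L)⁆ → ((φ w : _) : L) = ⁅a, ((φ v : _) : L)⁆) ∧
      (∀ a : L, ⁅x, a⁆ = 0 → ⁅f, a⁆ = 0 →
        ∀ T : Module.End ℂ (Module.End.eigenspace ((LieAlgebra.ad ℂ L) x) j),
          (∀ v, ((T v : _) : L) = ⁅a, (v : L)⁆) →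
          LinearMap.trace ℂ (Module.End.eigenspace ((LieAlgebra.ad ℂ L) x) j) T = 0) := by
  have h : IsHalfSl2Rep (LieAlgebra.ad ℂ L e) (LieAlgebra.ad ℂ L x) (LieAlgebra.ad ℂ L f) :=
    { X_E := fun v ↦ by simp [leibniz_lie x e v, hxe, add_comm]
      X_F := fun v ↦ by
          simp only [LieAlgebra.ad_apply]
          rw [leibniz_lie x f v, hxf, neg_lie, neg_add_eq_sub]
      E_F := fun v ↦ by simp [leibniz_lie e f v, hef, add_comm] }
  have hcomm {a b : L} (hab : ⁅b, a⁆ = 0) :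
      Commute (LieAlgebra.ad ℂ L a) (LieAlgebra.ad ℂ L b) := by
    refine LinearMap.ext fun v ↦ ?_
    have := leibniz_lie b a v
    rw [hab, zero_lie, zero_add] at this
    exact this.symm
  obtain ⟨φ, hφ⟩ := h.exists_equiv j
  have hmod (a : L) (hx : ⁅x, a⁆ = 0) (hf : ⁅f, a⁆ = 0) := hφ _ (hcomm hx) (hcomm hf)
  refine ⟨φ, hmod, fun a hx hf T hT ↦ ?_⟩
  have hinv (z u v : L) : killingForm ℂ L ⁅z, u⁆ v = -killingForm ℂ L u ⁅z, v⁆ :=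
    LieModule.traceForm_apply_lie_apply' ℂ L L z u v
  refine LinearMap.trace_eq_zero_of_pairing φ
    ((killingForm ℂ L).domRestrict₁₂ (End.eigenspace (LieAlgebra.ad ℂ L x) j)
      (End.eigenspace (LieAlgebra.ad ℂ L x) (-j))) ?_ T fun u v ↦ ?_
  · refine (injective_iff_map_eq_zero _).mpr fun u hu ↦ Subtype.ext ?_
    exact h.eq_zero_of_orthogonal (LieAlgebra.IsKilling.killingForm_nondegenerate ℂ L).1
      (hinv x) u.2 fun w hw ↦ congr($hu ⟨w, hw⟩)
  · have := hmod a hx hf v (T v) (hT v)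
    rw [LinearMap.domRestrict₁₂_apply, LinearMap.domRestrict₁₂_apply, this, hT u, hinv]
    rfl
end

section
/- In sl_n, the nilpotent orbit with partition (m₁ ≥ m₂ ≥ ⋯) contains in its closure the nilpotent orbit with partition (n₁ ≥ n₂ ≥ ⋯) if and only if m₁ + ⋯ + m_k ≥ n₁ + ⋯ + n_k for all k (dominance order). In particular, for a fixed m ≤ n, the partition (m,m,…,m,s) with n = qm + s, 0 ≤ s < m, is the unique maximal element in dominance order among partitions of n with all parts ≤ m. -/
open Module in
theorem Submodule.exists_between_finrank_eq {K V : Type*} [Field K] [AddCommGroup V] [Module K V]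
    [FiniteDimensional K V] {U W : Submodule K V} (hUW : U ≤ W) {d : ℕ}
    (hUd : finrank K U ≤ d) (hdW : d ≤ finrank K W) :
    ∃ X : Submodule K V, U ≤ X ∧ X ≤ W ∧ finrank K X = d := by
  induction d, hUd using Nat.le_induction with
  | base => exact ⟨U, le_rfl, hUW, rfl⟩
  | succ d hd ih =>
    obtain ⟨X, hUX, hXW, rfl⟩ := ih (by omega)
    obtain ⟨v, hvW, hvX⟩ : ∃ v ∈ W, v ∉ X := by
      by_contra! h
      have := Submodule.finrank_mono (show W ≤ X from h)
      omega
    refine ⟨X ⊔ span K {v}, hUX.trans le_sup_left, sup_le hXW ?_, ?_⟩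
    · simpa using hvW
    · exact Submodule.finrank_sup_span_singleton hvX

open Module in
theorem Submodule.finrank_map_add_finrank_inf_ker {K V V' : Type*} [Field K] [AddCommGroup V]
    [Module K V] [FiniteDimensional K V] [AddCommGroup V'] [Module K V'] (f : V →ₗ[K] V')
    (S : Submodule K V) :
    finrank K (S.map f) + finrank K (S ⊓ LinearMap.ker f : Submodule K V) = finrank K S := by
  have h := (f.domRestrict S).finrank_range_add_finrank_ker
  have h2 : finrank K (LinearMap.ker (f.domRestrict S))
      = finrank K (S ⊓ LinearMap.ker f : Submodule K V) := by
    rw [LinearMap.ker_domRestrict, ← Submodule.map_comap_subtype,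
      Submodule.finrank_map_subtype_eq]
  rwa [LinearMap.range_domRestrict, h2] at h

open Module in
/-- If `W` is `f`-stable and the kernels of the powers of `f` on `W` are at least as large as
prescribed by a concave sequence `d`, then `W` carries a flag with dimensions `d` that `f` shifts
down by one step. -/
theorem LinearMap.exists_flag {K V : Type*} [Field K] [AddCommGroup V] [Module K V]
    [FiniteDimensional K V] (f : V →ₗ[K] V) (d : ℕ → ℕ) (r : ℕ) (hd0 : d 0 = 0)
    (hmono : Monotone d) (hconc : ∀ j k, j ≤ k → d (k + 1) + d j ≤ d k + d (j + 1)) :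
    ∀ W : Submodule K V, W.map f ≤ W → finrank K W = d r →
      (∀ k ≤ r, d k ≤ finrank K (W ⊓ LinearMap.ker (f ^ k) : Submodule K V)) →
      ∃ F : ℕ → Submodule K V, F r = W ∧ (∀ k ≤ r, finrank K (F k) = d k) ∧
        ∀ k < r, F k ≤ F (k + 1) ∧ (F (k + 1)).map f ≤ F k := by
  induction r with
  | zero =>
    intro W _ hW _
    exact ⟨fun _ => W, rfl, fun k hk => by obtain rfl : k = 0 := (by omega); exact hW,
      fun k hk => by omega⟩
  | succ r ih =>
    intro W hfW hW hker
    set κ : ℕ → Submodule K V := fun k => W ⊓ LinearMap.ker (f ^ k) with hκ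
    have hκmono : Monotone κ := by
      refine monotone_nat_of_le_succ fun k => inf_le_inf_left _ fun x hx => ?_
      rw [LinearMap.mem_ker] at hx ⊢
      rw [pow_succ', Module.End.mul_apply, hx, map_zero]
    have hκtop : κ (r + 1) = W :=
      Submodule.eq_of_le_of_finrank_le inf_le_left (hW.trans_le (hker _ le_rfl))
    have hκmap : ∀ k, finrank K (W.map f ⊓ LinearMap.ker (f ^ k) : Submodule K V)
        + finrank K (κ 1) = finrank K (κ (k + 1)) := by
      intro k
      have h1 : (κ (k + 1)).map f = W.map f ⊓ LinearMap.ker (f ^ k) := by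
        ext x
        constructor
        · rintro ⟨y, ⟨hyW, hy⟩, rfl⟩
          refine ⟨⟨y, hyW, rfl⟩, ?_⟩
          simpa [pow_succ] using hy
        · rintro ⟨⟨y, hyW, rfl⟩, hy⟩
          exact ⟨y, ⟨hyW, by simpa [pow_succ] using hy⟩, rfl⟩
      have h2 : κ (k + 1) ⊓ LinearMap.ker f = κ 1 := by
        apply le_antisymm
        · exact fun x hx => ⟨hx.1.1, by simpa using hx.2⟩
        · exact fun x hx => ⟨hκmono (by omega) hx, by simpa using hx.2⟩
      rw [← h1, ← h2]
      exact Submodule.finrank_map_add_finrank_inf_ker f _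
    have hfWdim : finrank K (W.map f) + finrank K (κ 1) = finrank K W := by
      have := Submodule.finrank_map_add_finrank_inf_ker f W
      rwa [← pow_one f] at this
    set X : ℕ → Submodule K V := fun k => W.map f ⊔ κ k with hX
    have hXmono : Monotone X := fun i j hij => sup_le_sup_left (hκmono hij) _
    have hX0 : finrank K (X 0) ≤ d r := by
      have h1 := hker 1 (by omega)
      have h2 := hconc 0 r (by omega)
      have h3 : X 0 = W.map f := by
        simp [hX, hκ, Module.End.one_eq_id, LinearMap.ker_id]
      rw [h3]
      simp only [zero_add] at h2
      change d 1 ≤ finrank K (κ 1) at h1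
      omega
    obtain ⟨k, hkr, hk1, hk2⟩ :
        ∃ k ≤ r, finrank K (X k) ≤ d r ∧ d r ≤ finrank K (X (k + 1)) := by
      by_contra! hcon
      have h : ∀ k ≤ r + 1, finrank K (X k) ≤ d r := by
        intro k
        induction k with
        | zero => exact fun _ => hX0
        | succ k ihk => exact fun hk => (hcon k (by omega) (ihk (by omega))).le
      have h1 := hcon r le_rfl (h r (by omega))
      have h2 : W ≤ X (r + 1) := hκtop.ge.trans le_sup_right
      have h3 := Submodule.finrank_mono h2
      have h4 := hmono (Nat.le_succ r)
      simp only [Nat.succ_eq_add_one] at h4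
      omega
    obtain ⟨W', hkW, hWk, hW'⟩ :=
      Submodule.exists_between_finrank_eq (hXmono (Nat.le_succ k)) hk1 hk2
    have hW'W : W' ≤ W := hWk.trans (sup_le hfW inf_le_left)
    have hfWW' : W.map f ≤ W' := le_sup_left.trans hkW
    obtain ⟨F, hFr, hFd, hF⟩ := ih W' ((Submodule.map_mono hW'W).trans hfWW') hW' (by
      intro j hj
      rcases le_or_gt j k with hjk | hjk
      · refine (hker j (by omega)).trans (Submodule.finrank_mono ?_)
        exact le_inf ((hκmono hjk).trans (le_sup_right.trans hkW)) inf_le_right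
      · have h1 : W' = W.map f ⊔ (W' ⊓ LinearMap.ker (f ^ j)) := by
          apply le_antisymm
          · intro x hx
            obtain ⟨y, hy, z, hz, rfl⟩ := Submodule.mem_sup.1 (hXmono hjk (hWk hx))
            refine Submodule.add_mem_sup hy ⟨?_, hz.2⟩
            simpa using W'.sub_mem hx (hfWW' hy)
          · exact sup_le hfWW' inf_le_left
        have h2 := Submodule.finrank_sup_add_finrank_inf_eq (W.map f)
          (W' ⊓ LinearMap.ker (f ^ j))
        rw [← h1, ← inf_assoc, inf_eq_left.2 hfWW'] at h2
        have h3 := hκmap j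
        have h4 := hker (j + 1) (by omega)
        have h5 := hconc j r hj
        change d (j + 1) ≤ finrank K (κ (j + 1)) at h4
        omega)
    refine ⟨fun i => if i ≤ r then F i else W, by simp, ?_, ?_⟩
    · intro i hi
      rcases Nat.le_succ_iff.1 hi with h | rfl
      · exact (congrArg (fun S : Submodule K V => finrank K S) (if_pos h)).trans (hFd i h)
      · exact (congrArg (fun S : Submodule K V => finrank K S) (if_neg (by omega))).trans hW
    · intro i hi
      rcases Nat.lt_succ_iff_lt_or_eq.1 hi with h | rfl
      · simpa [h.le, Nat.succ_le_of_lt h] using hF i h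
      · simpa [hFr] using ⟨hW'W, hfWW'⟩

open Module in
/-- Modify a linear map away from `D` so that it embeds `T` into `T'`. -/
theorem LinearMap.exists_eqOn_injOn {K V V' : Type*} [Field K] [AddCommGroup V]
    [Module K V] [FiniteDimensional K V] [AddCommGroup V'] [Module K V'] [FiniteDimensional K V']
    (φ : V →ₗ[K] V') (T D : Submodule K V) (T' D' : Submodule K V')
    (hdim : finrank K T + finrank K (T' ⊓ D' : Submodule K V')
      = finrank K T' + finrank K (T ⊓ D : Submodule K V))
    (hinj : ∀ v ∈ T ⊓ D, φ v = 0 → v = 0) (hφ : ∀ v ∈ T ⊓ D, φ v ∈ T' ⊓ D') :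
    ∃ ψ : V →ₗ[K] V', (∀ v ∈ D, ψ v = φ v) ∧ (∀ v, ψ v - φ v ∈ T' ⊔ T.map φ) ∧
      (∀ v ∈ T, ψ v ∈ T') ∧ ∀ v ∈ T, ψ v = 0 → v = 0 := by
  obtain ⟨C, hC, hCT⟩ := IsModularLattice.exists_disjoint_and_sup_eq (inf_le_left : T ⊓ D ≤ T)
  obtain ⟨C', hC', hCT'⟩ :=
    IsModularLattice.exists_disjoint_and_sup_eq (inf_le_left : T' ⊓ D' ≤ T')
  have hCle : C ≤ T := hCT ▸ le_sup_right
  have hCle' : C' ≤ T' := hCT' ▸ le_sup_right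
  have hCdim : finrank K C = finrank K C' := by
    have h1 := Submodule.finrank_sup_add_finrank_inf_eq (T ⊓ D) C
    have h2 := Submodule.finrank_sup_add_finrank_inf_eq (T' ⊓ D') C'
    rw [hC.eq_bot, hCT, finrank_bot] at h1
    rw [hC'.eq_bot, hCT', finrank_bot] at h2
    omega
  let e : C ≃ₗ[K] C' := LinearEquiv.ofFinrankEq _ _ hCdim
  have hDC : Disjoint D C := by
    rw [Submodule.disjoint_def]
    exact fun x hxD hxC => Submodule.disjoint_def.1 hC x ⟨hCle hxC, hxD⟩ hxC
  obtain ⟨E, hDE, hE⟩ := hDC.exists_isCompl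
  set π : V →ₗ[K] C := C.projectionOnto E hE.symm with hπ
  have hπD : ∀ v ∈ D, π v = 0 := fun v hv =>
    (Submodule.projectionOnto_apply_eq_zero_iff hE.symm).2 (hDE hv)
  have hπC : ∀ v : C, π v = v := fun v => Submodule.projectionOnto_apply_left hE.symm v
  refine ⟨φ + (C'.subtype ∘ₗ e.toLinearMap - φ ∘ₗ C.subtype) ∘ₗ π, ?_, ?_, ?_, ?_⟩
  · intro v hv
    simp [hπD v hv]
  · intro v
    have : (φ + (C'.subtype ∘ₗ e.toLinearMap - φ ∘ₗ C.subtype) ∘ₗ π) v - φ v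
        = e (π v) - φ (π v) := by simp
    rw [this]
    exact Submodule.sub_mem _ (Submodule.mem_sup_left (hCle' (e (π v)).2))
      (Submodule.mem_sup_right ⟨_, hCle (π v).2, rfl⟩)
  all_goals
    intro v hv
    rw [← hCT] at hv
    obtain ⟨u, hu, c, hc, rfl⟩ := Submodule.mem_sup.1 hv
    have hval : (φ + (C'.subtype ∘ₗ e.toLinearMap - φ ∘ₗ C.subtype) ∘ₗ π) (u + c)
        = φ u + e ⟨c, hc⟩ := by
      have h1 := hπC ⟨c, hc⟩
      simp only at h1
      simp [hπD u hu.2, h1]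
    rw [hval]
  · exact T'.add_mem (hφ u hu).1 (hCle' (e ⟨c, hc⟩).2)
  · intro h0
    have h1 : φ u = 0 := Submodule.disjoint_def.1 hC' _ (hφ u hu) (by
      rw [eq_neg_of_add_eq_zero_left h0]
      exact C'.neg_mem (e ⟨c, hc⟩).2)
    rw [h1, zero_add] at h0
    have h2 : (⟨c, hc⟩ : C) = 0 := by simpa using h0
    rw [hinj u hu h1, zero_add]
    simpa using congrArg Subtype.val h2

open Module in
/-- Two flags with the same dimensions are matched by a linear map. -/
theorem LinearMap.exists_map_flag_le {K V V' : Type*} [Field K] [AddCommGroup V]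
    [Module K V] [FiniteDimensional K V] [AddCommGroup V'] [Module K V'] [FiniteDimensional K V']
    (U : ℕ → Submodule K V) (U' : ℕ → Submodule K V') (r : ℕ)
    (hU : ∀ k < r, U k ≤ U (k + 1)) (hU' : ∀ k < r, U' k ≤ U' (k + 1))
    (hdim : ∀ k ≤ r, finrank K (U k) = finrank K (U' k)) :
    ∃ φ : V →ₗ[K] V', (∀ k ≤ r, (U k).map φ ≤ U' k) ∧ ∀ v ∈ U r, φ v = 0 → v = 0 := by
  induction r with
  | zero =>
    obtain ⟨ψ, -, -, h1, h2⟩ := LinearMap.exists_eqOn_injOn (0 : V →ₗ[K] V') (U 0) ⊥ (U' 0) ⊥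
      (by rw [inf_bot_eq, inf_bot_eq, finrank_bot, finrank_bot, hdim 0 le_rfl]) (by simp) (by simp)
    refine ⟨ψ, fun k hk => ?_, h2⟩
    obtain rfl : k = 0 := by omega
    exact Submodule.map_le_iff_le_comap.2 h1
  | succ r ih =>
    obtain ⟨φ, hφ, hφi⟩ := ih (fun k hk => hU k (by omega)) (fun k hk => hU' k (by omega))
      (fun k hk => hdim k (by omega))
    have hr := inf_eq_right.2 (hU r (by omega))
    have hr' := inf_eq_right.2 (hU' r (by omega))
    obtain ⟨ψ, h0, -, h1, h2⟩ := LinearMap.exists_eqOn_injOn φ (U (r + 1)) (U r)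
      (U' (r + 1)) (U' r)
      (by rw [hr, hr', hdim r (by omega), hdim (r + 1) le_rfl])
      (by rwa [hr]) (by rw [hr, hr']; exact Submodule.map_le_iff_le_comap.1 (hφ r le_rfl))
    refine ⟨ψ, fun k hk => ?_, h2⟩
    rcases Nat.le_succ_iff.1 hk with h | rfl
    · rintro _ ⟨v, hv, rfl⟩
      have hle : U k ≤ U r := by
        clear * - hU h
        induction r, h using Nat.le_induction with
        | base => exact le_rfl
        | succ m _ ihm => exact (ihm fun k hk => hU k (by omega)).trans (hU m (by omega))
      rw [h0 v (hle hv)]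
      exact hφ k h ⟨v, hv, rfl⟩
    · exact Submodule.map_le_iff_le_comap.2 h1

theorem LinearMap.map_range_pow {K V : Type*} [Field K] [AddCommGroup V] [Module K V]
    (f : V →ₗ[K] V) (j : ℕ) :
    (LinearMap.range (f ^ j)).map f = LinearMap.range (f ^ (j + 1)) := by
  rw [pow_succ', Module.End.mul_eq_comp, LinearMap.range_comp]

theorem LinearMap.range_pow_succ_le {K V : Type*} [Field K] [AddCommGroup V] [Module K V]
    (f : V →ₗ[K] V) (j : ℕ) : LinearMap.range (f ^ (j + 1)) ≤ LinearMap.range (f ^ j) := by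
  rw [pow_succ, Module.End.mul_eq_comp]
  exact LinearMap.range_comp_le_range _ _

open Module in
theorem LinearMap.finrank_range_pow_succ_add {K V : Type*} [Field K] [AddCommGroup V] [Module K V]
    [FiniteDimensional K V] (f : V →ₗ[K] V) (j : ℕ) :
    finrank K (LinearMap.range (f ^ (j + 1)))
      + finrank K (LinearMap.ker f ⊓ LinearMap.range (f ^ j) : Submodule K V)
      = finrank K (LinearMap.range (f ^ j)) := by
  rw [← LinearMap.map_range_pow, inf_comm]
  exact Submodule.finrank_map_add_finrank_inf_ker f _

open Module in
/-- Nilpotent endomorphisms whose powers have the same ranks are intertwined by an injective map. -/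
theorem LinearMap.exists_injective_intertwining {K V V' : Type*} [Field K] [AddCommGroup V]
    [Module K V] [FiniteDimensional K V] [AddCommGroup V'] [Module K V'] [FiniteDimensional K V']
    (f : V →ₗ[K] V) (g : V' →ₗ[K] V') (N : ℕ) (hf : f ^ N = 0)
    (h : ∀ k, finrank K (LinearMap.range (f ^ k)) = finrank K (LinearMap.range (g ^ k))) :
    ∃ φ : V →ₗ[K] V', (∀ v, φ (f v) = g (φ v)) ∧ ∀ v, φ v = 0 → v = 0 := by
  suffices H : ∀ j ≤ N, ∃ φ : V →ₗ[K] V', ∀ v ∈ LinearMap.range (f ^ j),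
      φ (f v) = g (φ v) ∧ φ v ∈ LinearMap.range (g ^ j) ∧ (φ v = 0 → v = 0) by
    obtain ⟨φ, hφ⟩ := H 0 (Nat.zero_le _)
    exact ⟨φ, fun v => (hφ v (by simp)).1, fun v => (hφ v (by simp)).2.2⟩
  intro j hj
  induction hj using Nat.decreasingInduction with
  | self =>
    refine ⟨0, fun v hv => ?_⟩
    have : v = 0 := by simpa [hf, eq_comm] using hv
    simp [this]
  | @of_succ j hj ih =>
    obtain ⟨φ, hφ⟩ := ih
    set R := LinearMap.range (f ^ j)
    set S := LinearMap.range (f ^ (j + 1)) with hS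
    set R' := LinearMap.range (g ^ j)
    set S' := LinearMap.range (g ^ (j + 1)) with hS'
    have hfR : ∀ v ∈ R, f v ∈ S := fun v hv => by rw [hS, ← LinearMap.map_range_pow]; exact ⟨v, hv, rfl⟩
    have hgR : ∀ v ∈ R', g v ∈ S' := fun v hv => by rw [hS', ← LinearMap.map_range_pow]; exact ⟨v, hv, rfl⟩
    have hSR : S ≤ R := LinearMap.range_pow_succ_le f j
    have hSR' : S' ≤ R' := LinearMap.range_pow_succ_le g j
    obtain ⟨s, hs⟩ : ∃ s : V' →ₗ[K] V', ∀ y ∈ S', g (s y) = y ∧ s y ∈ R' := by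
      have hsurj : LinearMap.range (g.restrict hgR) = ⊤ := by
        rw [LinearMap.range_eq_top]
        rintro ⟨y, hy⟩
        have hy' := hy
        rw [hS', ← LinearMap.map_range_pow] at hy'
        obtain ⟨x, hx, hxy⟩ := hy'
        exact ⟨⟨x, hx⟩, Subtype.ext hxy⟩
      obtain ⟨t, ht⟩ := (g.restrict hgR).exists_rightInverse_of_surjective hsurj
      obtain ⟨s, hs⟩ := LinearMap.exists_extend (R'.subtype ∘ₗ t)
      refine ⟨s, fun y hy => ?_⟩
      have h1 : s y = t ⟨y, hy⟩ := by simpa using LinearMap.congr_fun hs ⟨y, hy⟩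
      have h2 := congrArg Subtype.val (LinearMap.congr_fun ht ⟨y, hy⟩)
      rw [h1]
      exact ⟨by simpa using h2, (t ⟨y, hy⟩).2⟩
    obtain ⟨C, hC⟩ := S.exists_isCompl
    set φ₁ : V →ₗ[K] V' := φ ∘ₗ S.subtype ∘ₗ S.projectionOnto C hC with hφ₁
    have hφ₁S : ∀ v ∈ S, φ₁ v = φ v := fun v hv => by
      simp [hφ₁, Submodule.projectionOnto_apply_of_mem_left hC hv]
    have hφ₁mem : ∀ v, φ₁ v ∈ S' := fun v => (hφ _ (S.projectionOnto C hC v).2).2.1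
    set φ₂ : V →ₗ[K] V' := φ₁ + s ∘ₗ (φ₁ ∘ₗ f - g ∘ₗ φ₁) with hφ₂
    have hdefect : ∀ v ∈ R, φ₁ (f v) - g (φ₁ v) ∈ S' := fun v hv =>
      S'.sub_mem (hφ₁mem _) (hgR _ (hSR' (hφ₁mem v)))
    have hφ₂R : ∀ v ∈ R, g (φ₂ v) = φ (f v) ∧ φ₂ v ∈ R' := by
      intro v hv
      obtain ⟨h1, h2⟩ := hs _ (hdefect v hv)
      constructor
      · simp only [hφ₂, LinearMap.add_apply, LinearMap.comp_apply, LinearMap.sub_apply, map_add, h1]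
        rw [hφ₁S _ (hfR v hv)]
        abel
      · exact R'.add_mem (hSR' (hφ₁mem v)) h2
    have hφ₂S : ∀ v ∈ S, φ₂ v = φ v := by
      intro v hv
      simp [hφ₂, hφ₁S v hv, hφ₁S _ (hfR v (hSR hv)), (hφ v hv).1]
    obtain ⟨ψ, hψS, hψ, -, hψi⟩ := LinearMap.exists_eqOn_injOn φ₂ (LinearMap.ker f ⊓ R) S
      (LinearMap.ker g ⊓ R') S'
      (by
        have e1 : LinearMap.ker f ⊓ R ⊓ S = LinearMap.ker f ⊓ S := by
          rw [inf_assoc, inf_eq_right.2 hSR]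
        have e2 : LinearMap.ker g ⊓ R' ⊓ S' = LinearMap.ker g ⊓ S' := by
          rw [inf_assoc, inf_eq_right.2 hSR']
        rw [e1, e2]
        have h1 : finrank K S + finrank K (LinearMap.ker f ⊓ R : Submodule K V) = finrank K R :=
          LinearMap.finrank_range_pow_succ_add f j
        have h2 : _ + finrank K (LinearMap.ker f ⊓ S : Submodule K V) = finrank K S :=
          LinearMap.finrank_range_pow_succ_add f (j + 1)
        have h3 : finrank K S' + finrank K (LinearMap.ker g ⊓ R' : Submodule K V') = finrank K R' :=
          LinearMap.finrank_range_pow_succ_add g j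
        have h4 : _ + finrank K (LinearMap.ker g ⊓ S' : Submodule K V') = finrank K S' :=
          LinearMap.finrank_range_pow_succ_add g (j + 1)
        have h5 : finrank K R = finrank K R' := h j
        have h6 : finrank K S = finrank K S' := h (j + 1)
        have h7 := h (j + 1 + 1)
        omega)
      (fun v hv h0 => (hφ v hv.2).2.2 (by rwa [hφ₂S v hv.2] at h0))
      (fun v hv => by
        have h1 := (hφ₂R v hv.1.2)
        have h2 : f v = 0 := hv.1.1
        rw [h2, map_zero] at h1
        exact ⟨⟨h1.1, h1.2⟩, by rw [hφ₂S v hv.2]; exact (hφ v hv.2).2.1⟩)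
    have hψ' : ∀ v, ψ v - φ₂ v ∈ LinearMap.ker g ⊓ R' := by
      intro v
      refine (sup_le le_rfl ?_ : _ ≤ LinearMap.ker g ⊓ R') (hψ v)
      rintro _ ⟨w, hw, rfl⟩
      have h1 := hφ₂R w hw.2
      have h2 : f w = 0 := hw.1
      rw [h2, map_zero] at h1
      exact h1
    have hcomm : ∀ v ∈ R, φ (f v) = g (ψ v) := by
      intro v hv
      have h1 : g (ψ v - φ₂ v) = 0 := (hψ' v).1
      rw [map_sub, sub_eq_zero] at h1
      rw [h1, (hφ₂R v hv).1]
    have hψf : ∀ v ∈ R, ψ (f v) = φ (f v) := fun v hv => by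
      rw [hψS _ (hfR v hv), hφ₂S _ (hfR v hv)]
    refine ⟨ψ, fun v hv => ⟨(hψf v hv).trans (hcomm v hv), ?_, fun h0 => ?_⟩⟩
    · simpa using R'.add_mem (hψ' v).2 (hφ₂R v hv).2
    · refine hψi v ⟨?_, hv⟩ h0
      have h1 := hcomm v hv
      rw [h0, map_zero] at h1
      exact (hφ _ (hfR v hv)).2.2 h1

theorem Matrix.exists_mul_mul_eq_one {n K : Type*} [Field K] [Fintype n] [DecidableEq n]
    (M : Matrix n n K) :
    ∃ (P : Matrix (Fin M.rank) n K) (Q : Matrix n (Fin M.rank) K), P * M * Q = 1 := by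
  obtain ⟨V, U, e, -, -, h⟩ := M.exists_rank_normal_form
  refine ⟨V.submatrix (e.symm ∘ Sum.inl) id, U.submatrix id (e.symm ∘ Sum.inl), ?_⟩
  have h1 : V.submatrix (e.symm ∘ Sum.inl) id * M * U.submatrix id (e.symm ∘ Sum.inl)
      = (V * M * U).submatrix (e.symm ∘ Sum.inl) (e.symm ∘ Sum.inl) := by
    ext i j
    simp [Matrix.mul_apply]
  rw [h1, h]
  ext i j
  simp [Matrix.one_apply]

theorem Matrix.le_rank_of_det_mul_mul_ne_zero {n K : Type*} [Field K] [Fintype n]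
    {r : ℕ} {M : Matrix n n K} {P : Matrix (Fin r) n K} {Q : Matrix n (Fin r) K}
    (h : (P * M * Q).det ≠ 0) : r ≤ M.rank := by
  have h1 := Matrix.rank_of_det_ne_zero h
  rw [Fintype.card_fin] at h1
  calc r = (P * M * Q).rank := h1.symm
    _ ≤ (P * M).rank := Matrix.rank_mul_le_left _ _
    _ ≤ M.rank := Matrix.rank_mul_le_right _ _

theorem Matrix.isClosed_setOf_rank_le {n K : Type*} [Field K] [TopologicalSpace K]
    [IsTopologicalRing K] [T1Space K] [Fintype n] (r : ℕ) :
    IsClosed {M : Matrix n n K | M.rank ≤ r} := by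
  classical
  rw [← isOpen_compl_iff, isOpen_iff_mem_nhds]
  intro M hM
  obtain ⟨P, Q, hPQ⟩ := M.exists_mul_mul_eq_one
  have hopen : IsOpen {N : Matrix n n K | (P * N * Q).det ≠ 0} :=
    isOpen_compl_singleton.preimage
      (f := fun N : Matrix n n K => (P * N * Q).det) (by fun_prop)
  refine Filter.mem_of_superset (hopen.mem_nhds (by simp [hPQ])) fun N hN => ?_
  have := Matrix.le_rank_of_det_mul_mul_ne_zero hN
  simp only [Set.mem_compl_iff, Set.mem_ofPred_eq, not_le] at hM ⊢
  omega

open Polynomial in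
/-- Along an affine line of matrices, the rank of a power drops below its value at the base point
only finitely often. -/
theorem Matrix.finite_setOf_rank_pow_add_smul_lt {n K : Type*} [Field K] [Fintype n]
    [DecidableEq n] (A D : Matrix n n K) (k : ℕ) :
    {t : K | ((A + t • D) ^ k).rank < (A ^ k).rank}.Finite := by
  obtain ⟨P, Q, hPQ⟩ := (A ^ k).exists_mul_mul_eq_one
  set f : K[X] :=
    (P.map C * (A.map C + (X : K[X]) • D.map C) ^ k * Q.map C).det with hf
  have heval : ∀ t, f.eval t = (P * (A + t • D) ^ k * Q).det := by
    intro t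
    have h1 : (A.map C + (X : K[X]) • D.map C).map (evalRingHom t) = A + t • D := by
      ext i j
      simp [mul_comm t]
    have h2 : ((A.map C + (X : K[X]) • D.map C) ^ k).map (evalRingHom t) = (A + t • D) ^ k := by
      rw [← h1]
      exact Matrix.map_pow (f := evalRingHom t) _ _
    have hP : (P.map C).map (evalRingHom t) = P := by ext i j; simp
    have hQ : (Q.map C).map (evalRingHom t) = Q := by ext i j; simp
    rw [← coe_evalRingHom, hf, RingHom.map_det, RingHom.mapMatrix_apply, Matrix.map_mul,
      Matrix.map_mul, h2, hP, hQ]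
  have hf0 : f ≠ 0 := by
    intro h0
    have := heval 0
    simp [h0, hPQ] at this
  refine (finite_setOfPred_isRoot hf0).subset fun t ht => ?_
  by_contra hroot
  have : f.eval t ≠ 0 := hroot
  rw [heval] at this
  exact absurd (Matrix.le_rank_of_det_mul_mul_ne_zero this) (not_le.2 ht)

open scoped Matrix in
theorem Matrix.exists_generalLinearGroup_mulVec_eq {n K : Type*} [Field K] [Fintype n]
    [DecidableEq n] (φ : (n → K) →ₗ[K] (n → K)) (hφ : ∀ v, φ v = 0 → v = 0) :
    ∃ g : GL n K, ∀ v, (g : Matrix n n K) *ᵥ v = φ v := by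
  have hunit : IsUnit φ :=
    (LinearMap.isUnit_iff_ker_eq_bot φ).2 (LinearMap.ker_eq_bot'.2 hφ)
  obtain ⟨g, hg⟩ := hunit.map LinearMap.toMatrixAlgEquiv'
  refine ⟨g, fun v => ?_⟩
  rw [hg]
  exact LinearMap.toMatrix'_mulVec φ v

open Module in
theorem Matrix.rank_pow_eq_finrank_range {n K : Type*} [Field K] [Fintype n] [DecidableEq n]
    (M : Matrix n n K) (k : ℕ) :
    (M ^ k).rank = finrank K (LinearMap.range (Matrix.toLin' M ^ k)) := by
  rw [← Matrix.toLin'_pow, Matrix.toLin'_apply']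
  rfl

open Module in
theorem Matrix.rank_pow_add_finrank_ker {n K : Type*} [Field K] [Fintype n] [DecidableEq n]
    (M : Matrix n n K) (k : ℕ) :
    (M ^ k).rank + finrank K (LinearMap.ker (Matrix.toLin' M ^ k)) = Fintype.card n := by
  rw [Matrix.rank_pow_eq_finrank_range, LinearMap.finrank_range_add_finrank_ker,
    finrank_fintype_fun_eq_card]

theorem Matrix.rank_units_conj_pow {n K : Type*} [Field K] [Fintype n] [DecidableEq n]
    (g : GL n K) (A : Matrix n n K) (k : ℕ) :
    (((g : Matrix n n K) * A * ((g⁻¹ : GL n K) : Matrix n n K)) ^ k).rank = (A ^ k).rank := by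
  rw [Units.conj_pow, Matrix.rank_mul_eq_left_of_isUnit_det _ _
    ((Matrix.isUnit_iff_isUnit_det _).1 (Units.isUnit _)),
    Matrix.rank_mul_eq_right_of_isUnit_det _ _
    ((Matrix.isUnit_iff_isUnit_det _).1 (Units.isUnit _))]

/-- Nilpotent matrices whose powers have the same ranks are conjugate. -/
theorem Matrix.exists_eq_units_conj_of_rank_pow_eq {n K : Type*} [Field K] [Fintype n]
    [DecidableEq n] {A M : Matrix n n K} {N : ℕ} (hA : A ^ N = 0)
    (h : ∀ k, (A ^ k).rank = (M ^ k).rank) :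
    ∃ g : GL n K, M = (g : Matrix n n K) * A * ((g⁻¹ : GL n K) : Matrix n n K) := by
  obtain ⟨φ, hφ, hφi⟩ := LinearMap.exists_injective_intertwining (Matrix.toLin' A)
    (Matrix.toLin' M) N (by rw [← Matrix.toLin'_pow, hA, map_zero])
    (fun k => by rw [← Matrix.rank_pow_eq_finrank_range, ← Matrix.rank_pow_eq_finrank_range, h])
  obtain ⟨g, hg⟩ := Matrix.exists_generalLinearGroup_mulVec_eq φ hφi
  refine ⟨g, (Units.eq_mul_inv_iff_mul_eq g).2 ?_⟩
  refine Matrix.toLin'.injective (LinearMap.ext fun v => ?_)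
  have h1 := hφ v
  simp only [Matrix.toLin'_apply] at h1
  simp only [Matrix.toLin'_mul, LinearMap.comp_apply, Matrix.toLin'_apply]
  rw [hg, hg]
  exact h1.symm

open Module Matrix in
/-- If the ranks of the powers of `B` are bounded by those of a nilpotent `A`, and the kernel
dimensions `d` of the powers of `A` form a concave sequence, then `B` is a limit of conjugates
of `A`. -/
theorem Matrix.mem_closure_conj_of_rank_pow_le {n : ℕ} {A B : Matrix (Fin n) (Fin n) ℂ}
    (d : ℕ → ℕ) (hd0 : d 0 = 0) (hdn : d n = n) (hmono : Monotone d)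
    (hconc : ∀ j k, j ≤ k → d (k + 1) + d j ≤ d k + d (j + 1))
    (hA : ∀ k, (A ^ k).rank + d k = n) (hAB : ∀ k, (B ^ k).rank ≤ (A ^ k).rank) :
    B ∈ closure {M : Matrix (Fin n) (Fin n) ℂ |
      ∃ g : GL (Fin n) ℂ, M = (g : Matrix (Fin n) (Fin n) ℂ) * A *
        ((g⁻¹ : GL (Fin n) ℂ) : Matrix (Fin n) (Fin n) ℂ)} := by
  have hkerA : ∀ k, finrank ℂ (LinearMap.ker (toLin' A ^ k)) = d k := fun k => by
    have h1 := Matrix.rank_pow_add_finrank_ker A k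
    have h2 := hA k
    rw [Fintype.card_fin] at h1
    omega
  have hAn : A ^ n = 0 := by
    rw [← Matrix.toLin'.map_eq_zero_iff, Matrix.toLin'_pow, ← LinearMap.ker_eq_top]
    apply Submodule.eq_top_of_finrank_eq
    rw [hkerA, hdn, finrank_fintype_fun_eq_card, Fintype.card_fin]
  obtain ⟨F, hFn, hFd, hF⟩ := LinearMap.exists_flag (toLin' B) d n hd0 hmono hconc ⊤ le_top
    (by rw [finrank_top, hdn, finrank_fintype_fun_eq_card, Fintype.card_fin])
    (fun k _ => by
      rw [top_inf_eq]
      have h1 := Matrix.rank_pow_add_finrank_ker B k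
      have h2 := hA k
      have h3 := hAB k
      rw [Fintype.card_fin] at h1
      omega)
  obtain ⟨φ, hφ, hφi⟩ := LinearMap.exists_map_flag_le
    (fun k => LinearMap.ker (toLin' A ^ k)) F n
    (fun k _ x hx => by
      rw [LinearMap.mem_ker] at hx ⊢
      rw [pow_succ', Module.End.mul_apply, hx, map_zero])
    (fun k hk => (hF k hk).1) (fun k hk => (hkerA k).trans (hFd k hk).symm)
  replace hφi : ∀ v, φ v = 0 → v = 0 := fun v => hφi v (by
    simp [← Matrix.toLin'_pow, hAn])
  have hφF : ∀ k ≤ n, (LinearMap.ker (toLin' A ^ k)).map φ = F k := fun k hk => by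
    refine Submodule.eq_of_le_of_finrank_eq (hφ k hk) ?_
    rw [← (Submodule.equivMapOfInjective φ ((injective_iff_map_eq_zero φ).2 hφi) _).finrank_eq,
      hkerA, hFd k hk]
  obtain ⟨g, hg⟩ := Matrix.exists_generalLinearGroup_mulVec_eq φ hφi
  set A' := (g : Matrix (Fin n) (Fin n) ℂ) * A *
    ((g⁻¹ : GL (Fin n) ℂ) : Matrix (Fin n) (Fin n) ℂ) with hA'
  have hA'F : ∀ k < n, ∀ x ∈ F (k + 1), A' *ᵥ x ∈ F k := by
    intro k hk x hx
    rw [← hφF (k + 1) hk] at hx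
    obtain ⟨u, hu, rfl⟩ := hx
    rw [← hφF k hk.le]
    refine ⟨A *ᵥ u, ?_, ?_⟩
    · simpa [pow_succ] using hu
    · rw [← hg, ← hg, Matrix.mulVec_mulVec, Matrix.mulVec_mulVec, hA', Units.inv_mul_cancel_right]
  have hBF : ∀ k < n, ∀ x ∈ F (k + 1), B *ᵥ x ∈ F k := fun k hk x hx =>
    (hF k hk).2 ⟨x, hx, rfl⟩
  have hline : ∀ (t : ℂ) (k : ℕ), ((A' + t • (B - A')) ^ k).rank ≤ (A ^ k).rank := by
    intro t
    set M := A' + t • (B - A') with hM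
    have hMF : ∀ k < n, ∀ x ∈ F (k + 1), M *ᵥ x ∈ F k := by
      intro k hk x hx
      rw [hM, Matrix.add_mulVec, Matrix.smul_mulVec, Matrix.sub_mulVec]
      exact (F k).add_mem (hA'F k hk x hx)
        ((F k).smul_mem t ((F k).sub_mem (hBF k hk x hx) (hA'F k hk x hx)))
    have hker : ∀ k ≤ n, F k ≤ LinearMap.ker (toLin' M ^ k) := by
      intro k
      induction k with
      | zero =>
        intro hk
        have h1 := hFd 0 hk
        rw [hd0, Submodule.finrank_eq_zero] at h1
        simp [h1]
      | succ k ih =>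
        intro hk x hx
        have := ih (by omega) (hMF k hk x hx)
        simpa [pow_succ] using this
    have hle : ∀ k ≤ n, (M ^ k).rank ≤ (A ^ k).rank := by
      intro k hk
      have h1 := Matrix.rank_pow_add_finrank_ker M k
      have h2 := hA k
      have h3 := Submodule.finrank_mono (hker k hk)
      rw [hFd k hk] at h3
      rw [Fintype.card_fin] at h1
      omega
    intro k
    rcases le_total k n with hk | hk
    · exact hle k hk
    · obtain ⟨i, rfl⟩ := Nat.exists_eq_add_of_le hk
      have h1 := hle n le_rfl
      have h2 := hA n
      have h3 := Matrix.rank_mul_le_left (M ^ n) (M ^ i)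
      rw [pow_add M]
      omega
  have hdense : Dense {t : ℂ | ∀ k, ((A' + t • (B - A')) ^ k).rank = (A ^ k).rank} := by
    have hcount : (⋃ k : ℕ,
        {t : ℂ | ((A' + t • (B - A')) ^ k).rank < (A' ^ k).rank}).Countable :=
      Set.countable_iUnion fun k =>
        (Matrix.finite_setOf_rank_pow_add_smul_lt A' (B - A') k).countable
    refine (hcount.dense_compl ℂ).mono fun t ht k => ?_
    simp only [Set.mem_compl_iff, Set.mem_iUnion, Set.mem_ofPred_eq, not_exists, not_lt] at ht
    exact le_antisymm (hline t k) ((Matrix.rank_units_conj_pow g A k).symm.trans_le (ht k))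
  have h1 : B = A' + (1 : ℂ) • (B - A') := by simp
  rw [h1]
  refine map_mem_closure (f := fun t : ℂ => A' + t • (B - A')) (by fun_prop) (hdense 1) fun t ht => ?_
  exact Matrix.exists_eq_units_conj_of_rank_pow_eq hAn fun k => (ht k).symm

theorem Finset.sum_range_le_of_sum_range_tsub_le {n : ℕ} {p q : ℕ → ℕ} (hp : Antitone p)
    (hq0 : ∀ i, n ≤ i → q i = 0)
    (h : ∀ k, ∑ i ∈ Finset.range n, (q i - k) ≤ ∑ i ∈ Finset.range n, (p i - k)) (k : ℕ) :
    ∑ i ∈ Finset.range k, q i ≤ ∑ i ∈ Finset.range k, p i := by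
  have h1 : ∑ i ∈ Finset.range k, (q i - p k) ≤ ∑ i ∈ Finset.range n, (q i - p k) := by
    refine Finset.sum_le_sum_of_ne_zero fun i _ hi => Finset.mem_range.2 ?_
    by_contra! hni
    simp [hq0 i hni] at hi
  have h2 : ∑ i ∈ Finset.range n, (p i - p k) ≤ ∑ i ∈ Finset.range k, (p i - p k) := by
    refine Finset.sum_le_sum_of_ne_zero fun i _ hi => Finset.mem_range.2 ?_
    by_contra! hki
    have := hp hki
    omega
  have h3 : ∑ i ∈ Finset.range k, q i ≤ ∑ i ∈ Finset.range k, ((q i - p k) + p k) :=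
    Finset.sum_le_sum fun i _ => by omega
  have h4 : ∑ i ∈ Finset.range k, ((p i - p k) + p k) = ∑ i ∈ Finset.range k, p i :=
    Finset.sum_congr rfl fun i hi => Nat.sub_add_cancel (hp (Finset.mem_range.1 hi).le)
  rw [Finset.sum_add_distrib] at h3 h4
  have h5 := h (p k)
  omega

theorem Finset.sum_range_tsub_le_of_sum_range_le {n : ℕ} {p q : ℕ → ℕ} (hq : Antitone q)
    (hp0 : ∀ i, n ≤ i → p i = 0) (hq0 : ∀ i, n ≤ i → q i = 0)
    (h : ∀ k, ∑ i ∈ Finset.range k, q i ≤ ∑ i ∈ Finset.range k, p i) (k : ℕ) :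
    ∑ i ∈ Finset.range n, (q i - k) ≤ ∑ i ∈ Finset.range n, (p i - k) := by
  have hex : ∃ j, q j ≤ k := ⟨n, by simp [hq0 n le_rfl]⟩
  obtain ⟨j, hj, hlt⟩ : ∃ j, q j ≤ k ∧ ∀ i < j, k < q i :=
    ⟨Nat.find hex, Nat.find_spec hex, fun i hi => not_le.1 (Nat.find_min hex hi)⟩
  have h1 : ∑ i ∈ Finset.range n, (q i - k) ≤ ∑ i ∈ Finset.range j, (q i - k) := by
    refine Finset.sum_le_sum_of_ne_zero fun i _ hi => Finset.mem_range.2 ?_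
    by_contra! hji
    have := hq hji
    omega
  have h2 : ∑ i ∈ Finset.range j, (p i - k) ≤ ∑ i ∈ Finset.range n, (p i - k) := by
    refine Finset.sum_le_sum_of_ne_zero fun i _ hi => Finset.mem_range.2 ?_
    by_contra! hni
    simp [hp0 i hni] at hi
  have h3 : ∑ i ∈ Finset.range j, ((q i - k) + k) = ∑ i ∈ Finset.range j, q i :=
    Finset.sum_congr rfl fun i hi => Nat.sub_add_cancel (hlt i (Finset.mem_range.1 hi)).le
  have h4 : ∑ i ∈ Finset.range j, p i ≤ ∑ i ∈ Finset.range j, ((p i - k) + k) :=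
    Finset.sum_le_sum fun i _ => by omega
  rw [Finset.sum_add_distrib] at h3 h4
  have h5 := h j
  omega

theorem Finset.sum_range_ite_lt_ite_eq (m a s k : ℕ) :
    ∑ i ∈ Finset.range k, (if i < a then m else if i = a then s else 0)
      = if k ≤ a then k * m else a * m + s := by
  induction k with
  | zero => simp
  | succ k ih =>
    rw [Finset.sum_range_succ, ih]
    rcases lt_trichotomy k a with h | rfl | h
    · rw [if_pos h.le, if_pos h, if_pos (Nat.succ_le_of_lt h), Nat.succ_mul]
    · simp
    · rw [if_neg (by omega), if_neg (by omega), if_neg (by omega), if_neg (by omega), add_zero]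

theorem Finset.eq_of_sum_range_eq {f g : ℕ → ℕ}
    (h : ∀ k, ∑ i ∈ Finset.range k, f i = ∑ i ∈ Finset.range k, g i) : f = g := by
  funext k
  have h1 := h (k + 1)
  rw [Finset.sum_range_succ, Finset.sum_range_succ, h k] at h1
  omega


/-- Closure order on nilpotent orbits of `sl_n` is the dominance order (Section 3.1 of
Kac–Wakimoto, after [CM]): a nilpotent `A` of Jordan type `p` (recorded by the ranks of
its powers) contains in its orbit closure the nilpotent `B` of Jordan type `q` iff the
partial sums of `p` dominate those of `q`.  Moreover, among partitions of `n` with all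
parts `≤ m`, the partition `(m,…,m,s)` (with `n = qq·m + s`, `0 ≤ s < m`) is the unique
maximal element in dominance order. -/
theorem stmt8 (n : ℕ) (p q : ℕ → ℕ) (hp : Antitone p) (hq : Antitone q)
    (hp0 : ∀ i, n ≤ i → p i = 0) (hq0 : ∀ i, n ≤ i → q i = 0)
    (hpn : ∑ i ∈ Finset.range n, p i = n) (hqn : ∑ i ∈ Finset.range n, q i = n)
    (A B : Matrix (Fin n) (Fin n) ℂ)
    (hA : ∀ k : ℕ, (A ^ k).rank = ∑ i ∈ Finset.range n, (p i - k))
    (hB : ∀ k : ℕ, (B ^ k).rank = ∑ i ∈ Finset.range n, (q i - k))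
    (m qq s : ℕ) (hm : 0 < m) (hmn : m ≤ n) (hdiv : n = qq * m + s) (hs : s < m) :
    (B ∈ closure {M : Matrix (Fin n) (Fin n) ℂ |
        ∃ g : GL (Fin n) ℂ, M = (g : Matrix (Fin n) (Fin n) ℂ) * A *
          ((g⁻¹ : GL (Fin n) ℂ) : Matrix (Fin n) (Fin n) ℂ)}
      ↔ ∀ k : ℕ, ∑ i ∈ Finset.range k, q i ≤ ∑ i ∈ Finset.range k, p i)
    ∧
    ((∀ i, q i ≤ m) →
      (∀ k : ℕ, ∑ i ∈ Finset.range k, q i ≤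
          ∑ i ∈ Finset.range k, (if i < qq then m else if i = qq then s else 0))
      ∧
      ((∀ k : ℕ, ∑ i ∈ Finset.range k, (if i < qq then m else if i = qq then s else 0) ≤
          ∑ i ∈ Finset.range k, q i) →
        q = fun i => if i < qq then m else if i = qq then s else 0)) := by
  have hpm : ∀ i ∈ Finset.range n, p i ≤ n := fun i hi =>
    (Finset.single_le_sum (fun _ _ => Nat.zero_le _) hi).trans_eq hpn
  refine ⟨⟨fun hB_mem => ?_, fun hdom => ?_⟩, fun hqm => ?_⟩
  · refine Finset.sum_range_le_of_sum_range_tsub_le hp hq0 fun k => ?_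
    have hclosed : IsClosed {M : Matrix (Fin n) (Fin n) ℂ | (M ^ k).rank ≤ (A ^ k).rank} :=
      (Matrix.isClosed_setOf_rank_le (A ^ k).rank).preimage (continuous_pow k)
    rw [← hA, ← hB]
    refine closure_minimal ?_ hclosed hB_mem
    rintro M ⟨g, rfl⟩
    exact (Matrix.rank_units_conj_pow g A k).le
  · refine Matrix.mem_closure_conj_of_rank_pow_le (fun k => ∑ i ∈ Finset.range n, min (p i) k)
      (by simp) ?_ ?_ ?_ ?_ ?_
    · exact (Finset.sum_congr rfl fun i hi => min_eq_left (hpm i hi)).trans hpn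
    · exact fun j k hjk => Finset.sum_le_sum fun i _ => min_le_min_left _ hjk
    · intro j k hjk
      simp only [← Finset.sum_add_distrib]
      exact Finset.sum_le_sum fun i _ => by omega
    · intro k
      rw [hA, ← Finset.sum_add_distrib]
      exact (Finset.sum_congr rfl fun i _ => by omega).trans hpn
    · intro k
      rw [hA, hB]
      exact Finset.sum_range_tsub_le_of_sum_range_le hq hp0 hq0 hdom k
  · have hle : ∀ k : ℕ, ∑ i ∈ Finset.range k, q i ≤
        ∑ i ∈ Finset.range k, (if i < qq then m else if i = qq then s else 0) := by
      intro k
      rw [Finset.sum_range_ite_lt_ite_eq]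
      split_ifs with hk
      · simpa using Finset.sum_le_card_nsmul (Finset.range k) q m fun i _ => hqm i
      · rw [← hdiv]
        refine (Finset.sum_le_sum_of_ne_zero fun i _ hi => Finset.mem_range.2 ?_).trans_eq hqn
        by_contra! hni
        exact hi (hq0 i hni)
    exact ⟨hle, fun hge => Finset.eq_of_sum_range_eq fun k => le_antisymm (hle k) (hge k)⟩
end

section
/- Let f(τ,s) = e^{πiτ/6} e^{πis} ∏_{n≥1} (1 - q^n e^{2πis})(1 - q^{n-1} e^{-2πis}) with q = e^{2πiτ}. Then for any fixed a ∈ ℂ, as τ → 0 along the positive imaginary axis, f(τ, -aτ) · e^{πi/(6τ)} → 2 sin(πa). -/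
/-- The function `f(τ,s)` of formula (2.7) of Kac–Wakimoto:
`f(τ,s) = e^{πiτ/6} e^{πis} ∏_{n≥1} (1 - qⁿ e^{2πis})(1 - q^{n-1} e^{-2πis})`, `q = e^{2πiτ}`. -/
noncomputable def fKW (τ s : ℂ) : ℂ :=
  Complex.exp ((Real.pi : ℂ) * Complex.I * τ / 6) *
    Complex.exp ((Real.pi : ℂ) * Complex.I * s) *
    ∏' n : ℕ,
      ((1 - Complex.exp (2 * (Real.pi : ℂ) * Complex.I * τ) ^ (n + 1) *
          Complex.exp (2 * (Real.pi : ℂ) * Complex.I * s)) *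
       (1 - Complex.exp (2 * (Real.pi : ℂ) * Complex.I * τ) ^ n *
          Complex.exp (-(2 * (Real.pi : ℂ) * Complex.I * s))))

open Complex Filter Topology ModularForm

/-- The product side of the Jacobi form, normalised by the square of the Euler product. -/
lemma tprod_mul_eq_sq_mul_tprod {q u v : ℂ} (hq : ‖q‖ < 1) {g : ℕ → ℂ}
    (hg : Multipliable fun n ↦ 1 + g n)
    (h : ∀ n, (1 - q ^ (n + 1)) ^ 2 * (1 + g n) = (1 - q ^ (n + 1) * u) * (1 - q ^ (n + 1) * v)) :
    ∏' n : ℕ, ((1 - q ^ (n + 1) * u) * (1 - q ^ n * v)) =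
      (1 - v) * (∏' n : ℕ, (1 - q ^ (n + 1))) ^ 2 * ∏' n, (1 + g n) := by
  have hmul (w : ℂ) : Multipliable fun n : ℕ ↦ 1 - q ^ (n + 1) * w := by
    simp_rw [sub_eq_add_neg]
    apply multipliable_one_add_of_summable
    simpa using ((summable_nat_add_iff 1).mpr
      (summable_geometric_of_lt_one (norm_nonneg _) hq)).mul_right ‖w‖
  have hmul' : Multipliable fun n : ℕ ↦ 1 - q ^ n * v := by
    simp_rw [sub_eq_add_neg]
    apply multipliable_one_add_of_summable
    simpa using (summable_geometric_of_lt_one (norm_nonneg _) hq).mul_right ‖v‖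
  have hP := multipliable_one_sub_pow hq
  have hsplit : (∏' n : ℕ, (1 - q ^ (n + 1) * u)) * ∏' n : ℕ, (1 - q ^ (n + 1) * v) =
      (∏' n : ℕ, (1 - q ^ (n + 1))) ^ 2 * ∏' n, (1 + g n) := by
    rw [← (hmul u).tprod_mul (hmul v), ← hP.tprod_pow 2, ← (hP.pow 2).tprod_mul hg]
    exact tprod_congr fun n ↦ (h n).symm
  have hzero : ∏' n : ℕ, (1 - q ^ n * v) = (1 - v) * ∏' n : ℕ, (1 - q ^ (n + 1) * v) := by
    have := tprod_eq_zero_mul' (f := fun n : ℕ ↦ 1 - q ^ n * v) (hmul v)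
    simpa only [pow_zero, one_mul] using this
  calc _ = (∏' n : ℕ, (1 - q ^ (n + 1) * u)) * ∏' n : ℕ, (1 - q ^ n * v) :=
        (hmul u).tprod_mul hmul'
    _ = _ := by rw [hzero, mul_left_comm, hsplit, mul_assoc]

lemma eta_I_mul_sq {t : ℝ} (ht : 0 < t) : η (I * t) ^ 2 = η (I / t) ^ 2 / t := by
  have ht' : (t : ℂ) ≠ 0 := by exact_mod_cast ht.ne'
  have hz : I / t ∈ UpperHalfPlane.upperHalfPlaneSet := by
    simpa [UpperHalfPlane.upperHalfPlaneSet, Complex.div_ofReal_im] using ht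
  have h := eta_comp_eq_csqrt_I_inv hz
  have hsq {z : ℂ} (hz : z ≠ 0) : sqrt z ^ 2 = z := by
    rw [sqrt_eq_exp hz, ← exp_nat_mul, Nat.cast_ofNat, mul_div_cancel₀ _ two_ne_zero, exp_log hz]
  have hz' : -1 / (I / t) = I * t := by
    field_simp
    simp
  simp only [Function.comp_apply, hz', Pi.smul_apply, Pi.mul_apply, smul_eq_mul] at h
  rw [h, mul_pow, mul_pow, inv_pow, hsq I_ne_zero, hsq (div_ne_zero I_ne_zero ht')]
  field_simp

lemma tendsto_tprod_one_sub_pow_zero :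
    Tendsto (fun q : ℂ ↦ ∏' n : ℕ, (1 - q ^ (n + 1))) (𝓝 0) (𝓝 1) := by
  have hball : Metric.ball (0 : ℂ) (1 / 2) ∈ 𝓝 0 := Metric.ball_mem_nhds 0 (by norm_num)
  have := tendsto_tprod_one_add_of_dominated_convergence (𝓕 := 𝓝 0) (g := 0)
    (f := fun (q : ℂ) (n : ℕ) ↦ -q ^ (n + 1)) (bound := fun n ↦ (1 / 2 : ℝ) ^ (n + 1))
    ((summable_nat_add_iff 1).mpr (summable_geometric_of_abs_lt_one (by norm_num)))
    (fun k ↦ by simpa using ((continuous_pow (M := ℂ) (k + 1)).tendsto 0).neg)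
    (by
      filter_upwards [hball] with q hq k
      simpa using pow_le_pow_left₀ (norm_nonneg _) (mem_ball_zero_iff.mp hq).le (k + 1))
  simpa [← sub_eq_add_neg] using this

lemma tendsto_eta_I_div_sq_mul_exp :
    Tendsto (fun t : ℝ ↦ η (I / t) ^ 2 * cexp (Real.pi * I / (6 * (I * t)))) (𝓝[>] 0) (𝓝 1) := by
  have hq : Tendsto (fun t : ℝ ↦ cexp (2 * Real.pi * I * (I / t))) (𝓝[>] 0) (𝓝 0) := by
    have h : Tendsto (fun t : ℝ ↦ Real.exp (-(2 * Real.pi * t⁻¹))) (𝓝[>] 0) (𝓝 0) :=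
      Real.tendsto_exp_neg_atTop_nhds_zero.comp
        (tendsto_inv_nhdsGT_zero.const_mul_atTop (by positivity))
    rw [tendsto_zero_iff_norm_tendsto_zero]
    refine h.congr fun t ↦ ?_
    have : 2 * Real.pi * I * (I / t) = ((-(2 * Real.pi * t⁻¹) : ℝ) : ℂ) := by
      push_cast
      linear_combination (2 * Real.pi * (t : ℂ)⁻¹) * I_mul_I
    rw [this, norm_exp, ofReal_re]
  have h := (tendsto_tprod_one_sub_pow_zero.comp hq).pow 2
  rw [one_pow] at h
  refine h.congr' ?_
  filter_upwards [self_mem_nhdsWithin] with t ht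
  have ht' : (t : ℂ) ≠ 0 := by exact_mod_cast (Set.mem_Ioi.mp ht).ne'
  have hexp : cexp (2 * Real.pi * I * (I / t) / 24) ^ 2 * cexp (Real.pi * I / (6 * (I * t))) = 1 := by
    rw [← exp_nat_mul, ← exp_add, exp_eq_one_iff]
    refine ⟨0, ?_⟩
    field_simp
    push_cast
    linear_combination (24 : ℂ) * I_sq
  simp only [ModularForm.eta, eta_q_eq_pow, Function.Periodic.qParam, Function.comp_apply, mul_pow]
  push_cast
  rw [mul_right_comm _ (_ ^ 2), hexp, one_mul]

lemma tendsto_sinh_mul_div (c : ℂ) :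
    Tendsto (fun t : ℝ ↦ Complex.sinh (c * t) / t) (𝓝[≠] 0) (𝓝 c) := by
  have h : HasDerivAt (fun t : ℝ ↦ Complex.sinh (c * t)) c 0 := by
    have h1 : HasDerivAt (fun z : ℂ ↦ Complex.sinh (c * z)) c ((0 : ℝ) : ℂ) := by
      simpa using ((hasDerivAt_id (0 : ℂ)).const_mul c).csinh
    exact h1.comp_ofReal
  simpa [hasDerivAt_iff_tendsto_slope, slope_fun_def, div_eq_inv_mul] using h

/-- The factors of the normalised product tend to those of Euler's product for the sine, and
are dominated by a summable sequence. -/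
lemma sinh_ratio_tendsto_and_bound (a : ℂ) :
    (∀ n : ℕ, Tendsto (fun t : ℝ ↦ -(Complex.sinh (Real.pi * a * t) /
      Complex.sinh (Real.pi * (n + 1) * t)) ^ 2) (𝓝[>] 0) (𝓝 (sineTerm a n))) ∧
    ∃ b : ℕ → ℝ, Summable b ∧ ∀ᶠ t : ℝ in 𝓝[>] 0, ∀ n : ℕ,
      ‖-(Complex.sinh (Real.pi * a * t) / Complex.sinh (Real.pi * (n + 1) * t)) ^ 2‖ ≤ b n := by
  have hle : 𝓝[>] (0 : ℝ) ≤ 𝓝[≠] 0 := nhdsWithin_mono _ fun x hx ↦ ne_of_gt hx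
  have hpi : (Real.pi : ℂ) ≠ 0 := by exact_mod_cast Real.pi_ne_zero
  have hS (c : ℂ) := (tendsto_sinh_mul_div c).mono_left hle
  refine ⟨fun n ↦ ?_, fun n ↦ (‖Real.pi * a‖ + 1) ^ 2 * (1 / ((n + 1 : ℕ) : ℝ) ^ 2),
    ((summable_nat_add_iff 1).mpr (Real.summable_one_div_nat_pow.mpr one_lt_two)).mul_left _, ?_⟩
  · have hn : (n + 1 : ℂ) ≠ 0 := Nat.cast_add_one_ne_zero n
    have h := (((hS (Real.pi * a)).div (hS (Real.pi * (n + 1))) (mul_ne_zero hpi hn)).pow 2).neg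
    have he : sineTerm a n = -(Real.pi * a / (Real.pi * (n + 1))) ^ 2 := by
      rw [mul_div_mul_left _ _ hpi, div_pow, sineTerm, neg_div]
    rw [he]
    refine h.congr' ?_
    filter_upwards [self_mem_nhdsWithin] with t ht
    have ht' : (t : ℂ) ≠ 0 := by exact_mod_cast (Set.mem_Ioi.mp ht).ne'
    rw [Pi.div_apply, div_div_div_cancel_right₀ ht']
  · have hev := (hS (Real.pi * a)).norm.eventually_lt_const (lt_add_one ‖(Real.pi * a : ℂ)‖)
    filter_upwards [self_mem_nhdsWithin, hev] with t ht hlt n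
    have ht0 : 0 < t := ht
    rw [norm_div, norm_real, Real.norm_of_nonneg ht0.le, div_lt_iff₀ ht0] at hlt
    have hden : (n + 1 : ℕ) * t ≤ ‖Complex.sinh (Real.pi * (n + 1) * t)‖ := by
      have : Complex.sinh (Real.pi * (n + 1) * t) =
          ((Real.sinh (Real.pi * ((n + 1 : ℕ) * t)) : ℝ) : ℂ) := by
        push_cast
        ring_nf
      rw [this, norm_real]
      have hpos : 0 ≤ (n + 1 : ℕ) * t := by positivity
      calc (n + 1 : ℕ) * t ≤ Real.pi * ((n + 1 : ℕ) * t) :=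
            le_mul_of_one_le_left hpos (by linarith [Real.pi_gt_three])
        _ ≤ Real.sinh (Real.pi * ((n + 1 : ℕ) * t)) := Real.self_le_sinh_iff.mpr (by positivity)
        _ ≤ _ := Real.le_norm_self _
    rw [norm_neg, norm_pow, norm_div, mul_one_div, ← div_pow]
    refine pow_le_pow_left₀ (by positivity) ?_ 2
    calc _ ≤ (‖(Real.pi * a : ℂ)‖ + 1) * t / ((n + 1 : ℕ) * t) :=
          div_le_div₀ (by positivity) hlt.le (by positivity) hden
      _ = _ := mul_div_mul_right _ _ ht0.ne'

lemma pi_mul_tprod_sineTerm (a : ℂ) :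
    Real.pi * a * ∏' n, (1 + sineTerm a n) = Complex.sin (Real.pi * a) := by
  rcases eq_or_ne a 0 with rfl | ha
  · simp
  · rw [tendsto_nhds_unique (multipliable_sineTerm a).hasProd.tendsto_prod_nat
      (tendsto_euler_sin_prod' ha)]
    have hpi : (Real.pi : ℂ) ≠ 0 := by exact_mod_cast Real.pi_ne_zero
    field_simp

/-- On the imaginary axis, `fKW τ (-a τ)` is `η(τ)²` times a product of ratios of `sinh`. -/
lemma fKW_eq_sinh_mul_eta_sq_mul_tprod (a : ℂ) {t : ℝ} (ht : 0 < t)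
    (hg : Multipliable fun n : ℕ ↦ 1 + -(Complex.sinh (Real.pi * a * t) /
      Complex.sinh (Real.pi * (n + 1) * t)) ^ 2) :
    fKW (I * t) (-a * (I * t)) = 2 * Complex.sinh (Real.pi * a * t) * η (I * t) ^ 2 *
      ∏' n : ℕ, (1 + -(Complex.sinh (Real.pi * a * t) /
        Complex.sinh (Real.pi * (n + 1) * t)) ^ 2) := by
  set x := cexp (Real.pi * a * t) with hx
  have hx0 : x ≠ 0 := exp_ne_zero _
  have hs : Complex.sinh (Real.pi * a * t) = (x - x⁻¹) / 2 := by rw [Complex.sinh, ← exp_neg]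
  have hu : cexp (2 * Real.pi * I * (-a * (I * t))) = x ^ 2 := by
    rw [hx, ← exp_nat_mul]
    congr 1
    push_cast
    linear_combination (-2 * Real.pi * a * t : ℂ) * I_sq
  have hv : cexp (-(2 * Real.pi * I * (-a * (I * t)))) = (x ^ 2)⁻¹ := by rw [exp_neg, hu]
  have hw : cexp (Real.pi * I * (-a * (I * t))) = x := by
    rw [hx]
    congr 1
    linear_combination (-Real.pi * a * t : ℂ) * I_sq
  set y := cexp (-(Real.pi * t)) with hy
  have hy0 : y ≠ 0 := exp_ne_zero _
  have hq : cexp (2 * Real.pi * I * (I * t)) = y ^ 2 := by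
    rw [hy, ← exp_nat_mul]
    congr 1
    push_cast
    linear_combination (2 * Real.pi * t : ℂ) * I_sq
  have hnorm : ‖y‖ < 1 := by
    rw [hy, norm_exp, Real.exp_lt_one_iff]
    simpa using mul_pos Real.pi_pos ht
  have hq1 : ‖y ^ 2‖ < 1 := by
    rw [norm_pow]
    exact pow_lt_one₀ (norm_nonneg _) hnorm two_ne_zero
  have hden (n : ℕ) : Complex.sinh (Real.pi * (n + 1) * t) =
      ((y ^ (n + 1))⁻¹ - y ^ (n + 1)) / 2 := by
    rw [Complex.sinh, hy, ← exp_nat_mul, ← exp_neg]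
    congr 3 <;> push_cast <;> ring
  have hprod := tprod_mul_eq_sq_mul_tprod (u := x ^ 2) (v := (x ^ 2)⁻¹) hq1 hg fun n ↦ by
    have hyn : y ^ (n + 1) ≠ 0 := pow_ne_zero _ hy0
    have hne : 1 - (y ^ (n + 1)) ^ 2 ≠ 0 := by
      rw [sub_ne_zero]
      intro h
      have : ‖(y ^ (n + 1)) ^ 2‖ < 1 := by
        rw [norm_pow, norm_pow]
        exact pow_lt_one₀ (by positivity) (pow_lt_one₀ (norm_nonneg _) hnorm n.succ_ne_zero)
          two_ne_zero
      rw [← h, norm_one] at this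
      exact this.false
    rw [hs, hden, pow_right_comm y 2]
    generalize y ^ (n + 1) = z at *
    have hz : z⁻¹ - z = (1 - z ^ 2) / z := by field_simp
    rw [hz]
    field_simp
    ring
  have heta : η (I * t) ^ 2 = cexp (Real.pi * I * (I * t) / 6) *
      (∏' n : ℕ, (1 - (y ^ 2) ^ (n + 1))) ^ 2 := by
    simp only [ModularForm.eta, eta_q_eq_pow, hq, Function.Periodic.qParam, mul_pow, ← exp_nat_mul]
    congr 2
    push_cast
    ring
  rw [fKW, hq, hu, hv, hw, hprod, heta, hs]
  field_simp

/-- Lemma 2.11(b) of Kac–Wakimoto: for fixed `a ∈ ℂ`, as `τ = it → 0` along the positive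
imaginary axis, `f(τ, -aτ) ∼ 2 sin(πa) e^{-πi/(6τ)}`, i.e.
`f(it, -a·it) · e^{πi/(6·it)} → 2 sin(πa)` as `t → 0⁺`. -/
theorem stmt11 (a : ℂ) :
    Filter.Tendsto
      (fun t : ℝ => fKW (Complex.I * t) (-a * (Complex.I * t)) *
        Complex.exp ((Real.pi : ℂ) * Complex.I / (6 * (Complex.I * t))))
      (nhdsWithin 0 (Set.Ioi 0))
      (nhds (2 * Complex.sin ((Real.pi : ℂ) * a))) := by
  obtain ⟨hlim, b, hb, hbound⟩ := sinh_ratio_tendsto_and_bound a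
  have hle : 𝓝[>] (0 : ℝ) ≤ 𝓝[≠] 0 := nhdsWithin_mono _ fun x hx ↦ ne_of_gt hx
  have h := (((tendsto_sinh_mul_div (Real.pi * a)).mono_left hle).const_mul 2).mul
    ((tendsto_tprod_one_add_of_dominated_convergence hb hlim hbound).mul
      tendsto_eta_I_div_sq_mul_exp)
  rw [mul_one, mul_assoc, pi_mul_tprod_sineTerm] at h
  refine h.congr' ?_
  filter_upwards [self_mem_nhdsWithin, hbound] with t ht hbt
  rw [fKW_eq_sinh_mul_eta_sq_mul_tprod a ht (multipliable_one_add_of_summable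
    (hb.of_nonneg_of_le (fun _ ↦ norm_nonneg _) hbt)), eta_I_mul_sq ht]
  ring
end
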